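/- Let p₁ < 1, let p₂, q₁, q₂ ∈ ℝ, let s₁, s₂ ≥ 0, let m ≥ 0, and let φ > 0. There exists a constant C > 0, depending only on p₁, p₂, q₁, q₂, s₁, s₂, m and φ, such that for every S > 0 and all x ≥ x₀ ≥ 1 satisfying √(1+S²)/S ≤ ⟨x₀⟩^{φ}, one has ∫_{x₀}^{x} e^{b(S)·(x−t)/4} · min( ⟨t⟩^{−q₁}·⟨x−t⟩^{s₁}·(x−t)^{−p₁} , ⟨t⟩^{−q₂}·⟨x−t⟩^{s₂}·(x−t)^{−p₂} ) dt ≤ C·( ⟨x⟩^{−q₁}·⟨x₀⟩^{2(1+s₁−p₁)φ} + ⟨x⟩^{−p₂−m}·⟨x₀⟩^{2(1+m+s₂)φ}·max(⟨x⟩^{−q₂}, ⟨x₀⟩^{−q₂}) ). -/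

import Mathlib

open MeasureTheory

/-- `⟨x⟩ = √(1+x²)`. -/
noncomputable def jap (x : ℝ) : ℝ := Real.sqrt (1 + x ^ 2)

/-- `b(α) = (1/4)(1 − √((1+√(1+16α²))/2))`. -/
noncomputable def bCoef (α : ℝ) : ℝ :=
  (1 / 4) * (1 - Real.sqrt ((1 + Real.sqrt (1 + 16 * α ^ 2)) / 2))

theorem s9_rpow_cmp {A B : ℝ} (r : ℝ) (hA : 0 < A) (h1 : A / 4 ≤ B) (h2 : B ≤ 4 * A) :
    B ^ r ≤ 4 ^ |r| * A ^ r := by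
  have hB : 0 < B := by linarith
  rcases le_total 0 r with h | h
  · rw [abs_of_nonneg h, ← Real.mul_rpow (by norm_num) hA.le]
    exact Real.rpow_le_rpow hB.le h2 h
  · rw [abs_of_nonpos h]
    have h3 : B ^ r ≤ (A / 4) ^ r := Real.rpow_le_rpow_of_nonpos (by positivity) h1 h
    rw [Real.div_rpow hA.le (by norm_num)] at h3
    rw [Real.rpow_neg (by norm_num)]
    calc B ^ r ≤ _ := h3
      _ = _ := by ring

theorem s9_jap_pos (x : ℝ) : 0 < jap x := by unfold jap; positivity

theorem s9_one_le_jap (x : ℝ) : 1 ≤ jap x := by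
  unfold jap; apply Real.one_le_sqrt.2; nlinarith [sq_nonneg x]

theorem s9_le_jap (x : ℝ) : x ≤ jap x := by
  unfold jap; apply Real.le_sqrt_of_sq_le; linarith

theorem s9_jap_mono {x y : ℝ} (hx : 0 ≤ x) (h : x ≤ y) : jap x ≤ jap y := by
  unfold jap; apply Real.sqrt_le_sqrt; nlinarith

theorem s9_jap_two {x y : ℝ} (hx : 0 ≤ x) (h : x ≤ 2 * y) : jap x ≤ 2 * jap y := by
  unfold jap
  apply Real.sqrt_le_iff.2
  refine ⟨by positivity, ?_⟩
  rw [mul_pow, Real.sq_sqrt (by positivity)]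
  nlinarith

theorem s9_jap_le_two {x : ℝ} (hx : 1 ≤ x) : jap x ≤ 2 * x := by
  unfold jap
  apply Real.sqrt_le_iff.2
  refine ⟨by positivity, ?_⟩
  nlinarith

theorem s9_jap_rpow_le {u s : ℝ} (hu : 0 < u) (hs : 0 ≤ s) :
    jap u ^ s ≤ 2 ^ s * (1 + u ^ s) := by
  have hu' : 0 ≤ u ^ s := Real.rpow_nonneg hu.le _
  have h2 : (0:ℝ) ≤ 2 ^ s := by positivity
  rcases le_total 1 u with h | h
  · calc jap u ^ s ≤ (2 * u) ^ s := Real.rpow_le_rpow (s9_jap_pos u).le (s9_jap_le_two h) hs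
      _ = 2 ^ s * u ^ s := Real.mul_rpow (by norm_num) hu.le
      _ ≤ _ := by nlinarith
  · calc jap u ^ s ≤ 2 ^ s := Real.rpow_le_rpow (s9_jap_pos u).le
          ((s9_jap_mono hu.le h).trans (by simpa using s9_jap_le_two (le_refl 1))) hs
      _ ≤ _ := by nlinarith

theorem s9_b {S R : ℝ} (hS : 0 < S) (h : Real.sqrt (1 + S ^ 2) / S ≤ R) :
    bCoef S ≤ - (1 / (8 * R ^ 2)) := by
  have hR : 0 < R := lt_of_lt_of_le (by positivity) h
  obtain ⟨w, hw⟩ : ∃ w, w = S ^ 2 / (1 + S ^ 2) := ⟨_, rfl⟩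
  have hw0 : 0 < w := by rw [hw]; positivity
  have hwS : w * (1 + S ^ 2) = S ^ 2 := by rw [hw]; field_simp
  have hw1 : w ≤ 1 := by rw [hw, div_le_one (by positivity)]; linarith
  have hwR : 1 / R ^ 2 ≤ w := by
    rw [hw, div_le_div_iff₀ (by positivity) (by positivity), one_mul]
    rw [div_le_iff₀ hS, Real.sqrt_le_iff] at h
    nlinarith [h.2]
  have hwS2 : w ≤ S ^ 2 := by nlinarith [sq_nonneg S, mul_nonneg hw0.le (sq_nonneg S)]
  have h1 : 1 + 4 * w ≤ Real.sqrt (1 + 16 * S ^ 2) := by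
    apply Real.le_sqrt_of_sq_le
    nlinarith [mul_nonneg hw0.le (sub_nonneg.2 hwS2)]
  have h2 : 1 + w / 2 ≤ Real.sqrt ((1 + Real.sqrt (1 + 16 * S ^ 2)) / 2) := by
    apply Real.le_sqrt_of_sq_le
    nlinarith
  have h3 : 1 / (8 * R ^ 2) = (1 / R ^ 2) / 8 := by field_simp
  unfold bCoef
  rw [h3]
  linarith

/-- Gamma integrand. -/
noncomputable def s9G (r e u : ℝ) : ℝ := u ^ (e - 1) * Real.exp (-(r * u))

theorem s9G_nonneg {r e u : ℝ} (hu : 0 < u) : 0 ≤ s9G r e u := by unfold s9G; positivity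

theorem s9G_integrable {r e : ℝ} (hr : 0 < r) (he : 0 < e) :
    IntegrableOn (s9G r e) (Set.Ioi 0) := by
  have := integrableOn_rpow_mul_exp_neg_mul_rpow (p := 1) (s := e - 1) (b := r)
    (by linarith) (by norm_num) hr
  refine this.congr_fun (fun u hu => ?_) measurableSet_Ioi
  simp [s9G]

theorem s9G_integral {r e : ℝ} (hr : 0 < r) (he : 0 < e) :
    ∫ u in Set.Ioi 0, s9G r e u = (1 / r) ^ e * Real.Gamma e :=
  Real.integral_rpow_mul_exp_neg_mul_Ioi he hr

/-- Integral comparison. -/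
theorem s9_int {f G : ℝ → ℝ} {x₀ x : ℝ} (hx : x₀ ≤ x) (hG : IntegrableOn G (Set.Ioi 0))
    (hG0 : ∀ u, 0 < u → 0 ≤ G u) (hf0 : ∀ t, x₀ < t → t < x → 0 ≤ f t)
    (hf : ∀ t, x₀ < t → t < x → f t ≤ G (x - t)) :
    ∫ t in x₀..x, f t ≤ ∫ u in Set.Ioi 0, G u := by
  have hI : IntervalIntegrable G volume 0 (x - x₀) := by
    rw [intervalIntegrable_iff_integrableOn_Ioc_of_le (by linarith)]
    exact hG.mono_set Set.Ioc_subset_Ioi_self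
  have hI2 : IntervalIntegrable (fun t => G (x - t)) volume x₀ x := by
    have := (hI.comp_sub_left x).symm
    simpa using this
  have e1 : ∫ t in x₀..x, G (x - t) = ∫ u in (0:ℝ)..(x - x₀), G u := by
    rw [intervalIntegral.integral_comp_sub_left, sub_self]
  calc ∫ t in x₀..x, f t ≤ ∫ t in x₀..x, G (x - t) := by
        rw [intervalIntegral.integral_of_le hx, intervalIntegral.integral_of_le hx,
          integral_Ioc_eq_integral_Ioo, integral_Ioc_eq_integral_Ioo]
        apply integral_mono_of_nonneg
        · exact (ae_restrict_iff' measurableSet_Ioo).2 (.of_forall fun t ht => hf0 t ht.1 ht.2)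
        · rw [intervalIntegrable_iff_integrableOn_Ioo_of_le hx] at hI2
          exact hI2
        · exact (ae_restrict_iff' measurableSet_Ioo).2 (.of_forall fun t ht => hf t ht.1 ht.2)
    _ = ∫ u in (0:ℝ)..(x - x₀), G u := e1
    _ ≤ _ := by
        rw [intervalIntegral.integral_of_le (by linarith)]
        apply setIntegral_mono_set hG
        · exact (ae_restrict_iff' measurableSet_Ioi).2 (.of_forall fun t ht => hG0 t ht)
        · exact Set.Ioc_subset_Ioi_self.eventuallyLE

theorem s9_gam {L e e' E : ℝ} (hL : 1 ≤ L) (he : 0 < e) (hE : 0 < e') (h : e ≤ E) (h' : e' ≤ E) :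
    (1 / (1 / (32 * L))) ^ e * Real.Gamma e + (1 / (1 / (32 * L))) ^ e' * Real.Gamma e'
      ≤ 32 ^ E * (Real.Gamma e + Real.Gamma e') * L ^ E := by
  rw [one_div_one_div]
  have g1 := Real.Gamma_pos_of_pos he
  have g2 := Real.Gamma_pos_of_pos hE
  have a1 : (32 * L) ^ e ≤ (32 * L) ^ E := Real.rpow_le_rpow_of_exponent_le (by linarith) h
  have a2 : (32 * L) ^ e' ≤ (32 * L) ^ E := Real.rpow_le_rpow_of_exponent_le (by linarith) h'
  have a3 : (32 * L) ^ E = 32 ^ E * L ^ E := Real.mul_rpow (by norm_num) (by linarith)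
  calc _ ≤ (32 * L) ^ E * Real.Gamma e + (32 * L) ^ E * Real.Gamma e' := by gcongr
    _ = _ := by rw [a3]; ring

/-- Pointwise bound near the diagonal. -/
theorem s9_near {p q s r x t : ℝ} (hs : 0 ≤ s) (hx : 1 ≤ x) (ht : x / 2 ≤ t) (htx : t < x) :
    Real.exp (-(r * (x - t))) * (jap t ^ (-q) * jap (x - t) ^ s * (x - t) ^ (-p)) ≤
      4 ^ |(-q)| * jap x ^ (-q) * 2 ^ s * (s9G r (1 - p) (x - t) + s9G r (1 + s - p) (x - t)) := by
  have hu : 0 < x - t := by linarith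
  have hj := s9_jap_pos x
  have h1 : jap t ^ (-q) ≤ 4 ^ |(-q)| * jap x ^ (-q) := by
    apply s9_rpow_cmp _ hj
    · have := s9_jap_two (x := x) (y := t) (by linarith) (by linarith); linarith
    · have := s9_jap_mono (x := t) (y := x) (by linarith) (by linarith); linarith
  have h2 := s9_jap_rpow_le hu hs
  have h3 : (x - t) ^ (1 + s - p - 1) = (x - t) ^ s * (x - t) ^ (-p) := by
    rw [← Real.rpow_add hu]; congr 1; ring
  have h4 : (x - t) ^ (1 - p - 1) = (x - t) ^ (-p) := by congr 1; ring
  have hjt := s9_jap_pos t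
  have hju := s9_jap_pos (x - t)
  unfold s9G
  rw [h3, h4]
  calc _ ≤ Real.exp (-(r * (x - t))) * ((4 ^ |(-q)| * jap x ^ (-q)) *
        (2 ^ s * (1 + (x - t) ^ s)) * (x - t) ^ (-p)) := by gcongr
    _ = _ := by ring

/-- Pointwise bound far from the diagonal. -/
theorem s9_far {p q s m r x₀ x t : ℝ} (hs : 0 ≤ s) (hm : 0 ≤ m) (hx₀ : 1 ≤ x₀)
    (hxt : x₀ < t) (ht : t ≤ x / 2) :
    Real.exp (-(r * (x - t))) * (jap t ^ (-q) * jap (x - t) ^ s * (x - t) ^ (-p)) ≤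
      4 ^ |(-p)| * jap x ^ (-p - m) * max (jap x ^ (-q)) (jap x₀ ^ (-q)) * 2 ^ m * 2 ^ (s + m) *
        (s9G r 1 (x - t) + s9G r (1 + m + s) (x - t)) := by
  have hu : 0 < x - t := by linarith
  have hj := s9_jap_pos x
  have hj0 := s9_jap_pos x₀
  have hjt := s9_jap_pos t
  have hju := s9_jap_pos (x - t)
  have h1 : jap t ^ (-q) ≤ max (jap x ^ (-q)) (jap x₀ ^ (-q)) := by
    rcases le_total 0 (-q) with h | h
    · exact le_max_of_le_left (Real.rpow_le_rpow hjt.le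
        (s9_jap_mono (by linarith) (by linarith)) h)
    · exact le_max_of_le_right (Real.rpow_le_rpow_of_nonpos hj0
        (s9_jap_mono (by linarith) (by linarith)) h)
  have h2 : (x - t) ^ (-p) ≤ 4 ^ |(-p)| * jap x ^ (-p) := by
    apply s9_rpow_cmp _ hj
    · have := s9_jap_le_two (x := x) (by linarith); linarith
    · have := s9_le_jap x; linarith
  have h3 : jap x ^ m ≤ 2 ^ m * jap (x - t) ^ m := by
    rw [← Real.mul_rpow (by norm_num) hju.le]
    exact Real.rpow_le_rpow hj.le (s9_jap_two (by linarith) (by linarith)) hm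
  have h4 : jap x ^ (-p) = jap x ^ (-p - m) * jap x ^ m := by
    rw [← Real.rpow_add hj]; congr 1; ring
  have h5 := s9_jap_rpow_le hu (add_nonneg hs hm)
  have h6 : jap (x - t) ^ (s + m) = jap (x - t) ^ s * jap (x - t) ^ m := Real.rpow_add hju _ _
  have h7 : (x - t) ^ (1 + m + s - 1) = (x - t) ^ (s + m) := by congr 1; ring
  unfold s9G
  rw [h7, sub_self, Real.rpow_zero]
  have hM : 0 ≤ max (jap x ^ (-q)) (jap x₀ ^ (-q)) := le_max_of_le_left (by positivity)
  calc _ ≤ Real.exp (-(r * (x - t))) * (max (jap x ^ (-q)) (jap x₀ ^ (-q)) * jap (x - t) ^ s *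
        (4 ^ |(-p)| * (jap x ^ (-p - m) * (2 ^ m * jap (x - t) ^ m)))) := by
        have h8 : (x - t) ^ (-p) ≤ 4 ^ |(-p)| * (jap x ^ (-p - m) * (2 ^ m * jap (x - t) ^ m)) := by
          refine h2.trans ?_
          rw [h4]; gcongr
        gcongr
    _ = Real.exp (-(r * (x - t))) * (max (jap x ^ (-q)) (jap x₀ ^ (-q)) *
        (4 ^ |(-p)| * (jap x ^ (-p - m) * (2 ^ m * jap (x - t) ^ (s + m))))) := by rw [h6]; ring
    _ ≤ Real.exp (-(r * (x - t))) * (max (jap x ^ (-q)) (jap x₀ ^ (-q)) *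
        (4 ^ |(-p)| * (jap x ^ (-p - m) * (2 ^ m * (2 ^ (s + m) * (1 + (x - t) ^ (s + m))))))) := by
        gcongr
    _ = _ := by ring

set_option maxHeartbeats 1000000 in
theorem stmt9 (p₁ p₂ q₁ q₂ s₁ s₂ m φ : ℝ) (hp₁ : p₁ < 1) (hs₁ : 0 ≤ s₁) (hs₂ : 0 ≤ s₂)
    (hm : 0 ≤ m) (hφ : 0 < φ) :
    ∃ C : ℝ, 0 < C ∧ ∀ S x₀ x : ℝ, 0 < S → 1 ≤ x₀ → x₀ ≤ x →
      Real.sqrt (1 + S ^ 2) / S ≤ jap x₀ ^ φ →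
      (∫ t in x₀..x, Real.exp (bCoef S * (x - t) / 4) *
          min (jap t ^ (-q₁) * jap (x - t) ^ s₁ * (x - t) ^ (-p₁))
            (jap t ^ (-q₂) * jap (x - t) ^ s₂ * (x - t) ^ (-p₂))) ≤
        C * (jap x ^ (-q₁) * jap x₀ ^ (2 * (1 + s₁ - p₁) * φ) +
          jap x ^ (-p₂ - m) * jap x₀ ^ (2 * (1 + m + s₂) * φ) *
            max (jap x ^ (-q₂)) (jap x₀ ^ (-q₂))) := by
  have hg1 := Real.Gamma_pos_of_pos (show 0 < 1 - p₁ by linarith)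
  have hg2 := Real.Gamma_pos_of_pos (show 0 < 1 + s₁ - p₁ by linarith)
  have hg3 := Real.Gamma_pos_of_pos (show (0:ℝ) < 1 by norm_num)
  have hg4 := Real.Gamma_pos_of_pos (show 0 < 1 + m + s₂ by linarith)
  obtain ⟨C₁, hC₁⟩ : ∃ C, C = 4 ^ |(-q₁)| * 2 ^ s₁ *
    (32 ^ (1 + s₁ - p₁) * (Real.Gamma (1 - p₁) + Real.Gamma (1 + s₁ - p₁))) := ⟨_, rfl⟩
  obtain ⟨C₂, hC₂⟩ : ∃ C, C = 4 ^ |(-p₂)| * 2 ^ m * 2 ^ (s₂ + m) *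
    (32 ^ (1 + m + s₂) * (Real.Gamma 1 + Real.Gamma (1 + m + s₂))) := ⟨_, rfl⟩
  have hC₁p : 0 < C₁ := by rw [hC₁]; positivity
  have hC₂p : 0 < C₂ := by rw [hC₂]; positivity
  refine ⟨C₁ + C₂, by positivity, ?_⟩
  intro S x₀ x hS hx₀ hx hR
  have hj := s9_jap_pos x
  have hj0 := s9_jap_pos x₀
  obtain ⟨L, hL⟩ : ∃ L, L = (jap x₀ ^ φ) ^ 2 := ⟨_, rfl⟩
  have hL1 : 1 ≤ L := by
    rw [hL]; exact one_le_pow₀ (Real.one_le_rpow (s9_one_le_jap x₀) hφ.le)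
  have hLe : ∀ e : ℝ, L ^ e = jap x₀ ^ (2 * e * φ) := by
    intro e
    rw [hL, ← Real.rpow_natCast, ← Real.rpow_mul hj0.le, ← Real.rpow_mul hj0.le]
    congr 1; push_cast; ring
  have hb := s9_b hS hR
  rw [← hL] at hb
  obtain ⟨r, hr⟩ : ∃ r, r = 1 / (32 * L) := ⟨_, rfl⟩
  have hr0 : 0 < r := by rw [hr]; positivity
  have hbr : bCoef S / 4 ≤ -r := by
    have : r = 1 / (8 * L) / 4 := by rw [hr]; field_simp; norm_num
    linarith
  obtain ⟨M, hM⟩ : ∃ M, M = max (jap x ^ (-q₂)) (jap x₀ ^ (-q₂)) := ⟨_, rfl⟩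
  have hM0 : 0 ≤ M := by rw [hM]; exact le_max_of_le_left (by positivity)
  obtain ⟨A₁, hA₁⟩ : ∃ A, A = 4 ^ |(-q₁)| * jap x ^ (-q₁) * 2 ^ s₁ := ⟨_, rfl⟩
  obtain ⟨A₂, hA₂⟩ : ∃ A, A = 4 ^ |(-p₂)| * jap x ^ (-p₂ - m) * M * 2 ^ m * 2 ^ (s₂ + m) :=
    ⟨_, rfl⟩
  have hA₁p : 0 ≤ A₁ := by rw [hA₁]; positivity
  have hA₂p : 0 ≤ A₂ := by rw [hA₂]; positivity
  have i1 := s9G_integrable hr0 (show 0 < 1 - p₁ by linarith)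
  have i2 := s9G_integrable hr0 (show 0 < 1 + s₁ - p₁ by linarith)
  have i3 := s9G_integrable hr0 (show (0:ℝ) < 1 by norm_num)
  have i4 := s9G_integrable hr0 (show 0 < 1 + m + s₂ by linarith)
  have j1 : IntegrableOn (fun u => A₁ * (s9G r (1 - p₁) u + s9G r (1 + s₁ - p₁) u))
    (Set.Ioi 0) := (i1.add i2).const_mul A₁
  have j2 : IntegrableOn (fun u => A₂ * (s9G r 1 u + s9G r (1 + m + s₂) u))
    (Set.Ioi 0) := (i3.add i4).const_mul A₂
  have key := s9_int (x₀ := x₀) (x := x) (f := fun t => Real.exp (bCoef S * (x - t) / 4) *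
          min (jap t ^ (-q₁) * jap (x - t) ^ s₁ * (x - t) ^ (-p₁))
            (jap t ^ (-q₂) * jap (x - t) ^ s₂ * (x - t) ^ (-p₂)))
    (G := fun u => A₁ * (s9G r (1 - p₁) u + s9G r (1 + s₁ - p₁) u) +
      A₂ * (s9G r 1 u + s9G r (1 + m + s₂) u)) hx (j1.add j2) ?_ ?_ ?_
  · refine key.trans ?_
    rw [integral_add j1 j2, integral_const_mul, integral_const_mul, integral_add i1 i2,
      integral_add i3 i4, s9G_integral hr0 (by linarith), s9G_integral hr0 (by linarith),
      s9G_integral hr0 (by linarith), s9G_integral hr0 (by linarith), hr, ← hM, ← hLe, ← hLe]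
    have k1 := s9_gam hL1 (show 0 < 1 - p₁ by linarith) (show 0 < 1 + s₁ - p₁ by linarith)
      (show 1 - p₁ ≤ 1 + s₁ - p₁ by linarith) le_rfl
    have k2 := s9_gam hL1 (show (0:ℝ) < 1 by norm_num) (show 0 < 1 + m + s₂ by linarith)
      (show 1 ≤ 1 + m + s₂ by linarith) le_rfl
    have l1 := mul_le_mul_of_nonneg_left k1 hA₁p
    have l2 := mul_le_mul_of_nonneg_left k2 hA₂p
    obtain ⟨X, hX⟩ : ∃ X, X = jap x ^ (-q₁) * L ^ (1 + s₁ - p₁) := ⟨_, rfl⟩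
    obtain ⟨Y, hY⟩ : ∃ Y, Y = jap x ^ (-p₂ - m) * L ^ (1 + m + s₂) * M := ⟨_, rfl⟩
    have hL0 : 0 < L := by linarith
    have hX0 : 0 ≤ X := by rw [hX]; positivity
    have hY0 : 0 ≤ Y := by rw [hY]; positivity
    refine (add_le_add l1 l2).trans ?_
    rw [← hX, ← hY]
    calc _ = C₁ * X + C₂ * Y := by rw [hA₁, hA₂, hC₁, hC₂, hX, hY]; ring
      _ ≤ (C₁ + C₂) * (X + Y) := by nlinarith [mul_nonneg hC₁p.le hY0, mul_nonneg hC₂p.le hX0]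
  · intro u hu
    have g1 := s9G_nonneg (r := r) (e := 1 - p₁) hu
    have g2 := s9G_nonneg (r := r) (e := 1 + s₁ - p₁) hu
    have g3 := s9G_nonneg (r := r) (e := 1) hu
    have g4 := s9G_nonneg (r := r) (e := 1 + m + s₂) hu
    positivity
  · intro t h1 h2
    have hu : 0 < x - t := by linarith
    have hjt := s9_jap_pos t
    have hju := s9_jap_pos (x - t)
    exact mul_nonneg (Real.exp_pos _).le (le_min (by positivity) (by positivity))
  · intro t h1 h2
    have hu : 0 < x - t := by linarith
    have hjt := s9_jap_pos t
    have hju := s9_jap_pos (x - t)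
    have g1 := s9G_nonneg (r := r) (e := 1 - p₁) hu
    have g2 := s9G_nonneg (r := r) (e := 1 + s₁ - p₁) hu
    have g3 := s9G_nonneg (r := r) (e := 1) hu
    have g4 := s9G_nonneg (r := r) (e := 1 + m + s₂) hu
    have hexp : Real.exp (bCoef S * (x - t) / 4) ≤ Real.exp (-(r * (x - t))) := by
      apply Real.exp_le_exp.2
      have := mul_le_mul_of_nonneg_right hbr hu.le
      calc bCoef S * (x - t) / 4 = bCoef S / 4 * (x - t) := by ring
        _ ≤ -r * (x - t) := this
        _ = _ := by ring
    have hmin : 0 ≤ min (jap t ^ (-q₁) * jap (x - t) ^ s₁ * (x - t) ^ (-p₁))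
            (jap t ^ (-q₂) * jap (x - t) ^ s₂ * (x - t) ^ (-p₂)) :=
      le_min (by positivity) (by positivity)
    refine (mul_le_mul_of_nonneg_right hexp hmin).trans ?_
    rcases le_total (x / 2) t with h | h
    · refine (mul_le_mul_of_nonneg_left (min_le_left _ _) (Real.exp_pos _).le).trans ?_
      refine (s9_near hs₁ (by linarith) h h2).trans ?_
      rw [← hA₁]
      exact le_add_of_nonneg_right (by positivity)
    · refine (mul_le_mul_of_nonneg_left (min_le_right _ _) (Real.exp_pos _).le).trans ?_
      refine (s9_far hs₂ hm hx₀ h1 h).trans ?_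
      rw [← hM, ← hA₂]
      exact le_add_of_nonneg_left (by positivity)
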